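/- Assume P is irreducible and μ(i) > 0 for every i ∈ D. Then for every i ∈ D, as M → ∞, the random variables √M·(ũ_M(i) − u(i)) converge in distribution to the centered Gaussian law N(0, σ_i²). -/

import Mathlib

open MeasureTheory Finset Filter
open scoped ENNReal NNReal ENat

noncomputable section

namespace RareTD

variable {n : ℕ}

/-- `P` is a row-stochastic matrix. -/
def IsStochastic (P : Matrix (Fin n) (Fin n) ℝ) : Prop :=
  (∀ i j, 0 ≤ P i j) ∧ ∀ i, ∑ j, P i j = 1

/-- Irreducibility of a nonnegative matrix. -/
def IsIrreducible (P : Matrix (Fin n) (Fin n) ℝ) : Prop :=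
  ∀ i j, ∃ m : ℕ, 0 < m ∧ 0 < (P ^ m) i j

/-- `Pr i` is the law of the Markov chain with transition matrix `P` started at `i`,
characterized by its finite-dimensional distributions. -/
def IsMarkovFamily (P : Matrix (Fin n) (Fin n) ℝ)
    (Pr : Fin n → Measure (ℕ → Fin n)) : Prop :=
  (∀ i, IsProbabilityMeasure (Pr i)) ∧
    ∀ (i : Fin n) (m : ℕ) (x : ℕ → Fin n),
      (Pr i {ω | ∀ t ≤ m, ω t = x t}).toReal =
        (if x 0 = i then 1 else 0) * ∏ t ∈ Finset.range m, P (x t) (x (t + 1))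

/-- The matrix `S` of the chain stopped on exiting `D`. -/
def stopMat (P : Matrix (Fin n) (Fin n) ℝ) (D : Finset (Fin n)) :
    Matrix (Fin n) (Fin n) ℝ :=
  fun i j => if i ∈ D then P i j else if i = j then 1 else 0

/-- Exit time `T = min {t ≥ 0 : ω t ∉ D}`, with value `⊤` if the path never leaves `D`. -/
def exitT (D : Finset (Fin n)) (ω : ℕ → Fin n) : ℕ∞ :=
  ⨅ (t : ℕ) (_ : ω t ∉ D), (t : ℕ∞)

/-- Hitting time of a set at positive times, `min {t > 0 : ω t ∈ A}`. -/
def hitT (A : Set (Fin n)) (ω : ℕ → Fin n) : ℕ∞ :=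
  ⨅ (t : ℕ) (_ : 0 < t ∧ ω t ∈ A), (t : ℕ∞)

/-- The stopped path `t ↦ X_{t ∧ T}`. -/
def stopped (D : Finset (Fin n)) (ω : ℕ → Fin n) : ℕ → Fin n
  | 0 => ω 0
  | t + 1 => if stopped D ω t ∈ D then ω (t + 1) else stopped D ω t

/-- `R_D`, the reward restricted to `D`. -/
def RD (D : Finset (Fin n)) (R : Fin n → ℝ) : Fin n → ℝ := fun i => if i ∈ D then R i else 0

/-- The value function `u(i) = E_i[∑_{t=0}^{T} R(X_t)]`, in `[0,∞]`. -/
def valueE (Pr : Fin n → Measure (ℕ → Fin n)) (D : Finset (Fin n)) (R : Fin n → ℝ)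
    (i : Fin n) : ℝ≥0∞ :=
  ∑' t : ℕ, ∫⁻ ω, Set.indicator {ω' : ℕ → Fin n | (t : ℕ∞) ≤ exitT D ω'}
      (fun ω' => ENNReal.ofReal (R (ω' t))) ω ∂(Pr i)

/-- The real-valued value function. -/
def valueR (Pr : Fin n → Measure (ℕ → Fin n)) (D : Finset (Fin n)) (R : Fin n → ℝ)
    (i : Fin n) : ℝ := (valueE Pr D R i).toReal

/-- Replace by `0` every row and column with index outside `D`. -/
def zeroD (D : Finset (Fin n)) (M : Matrix (Fin n) (Fin n) ℝ) : Matrix (Fin n) (Fin n) ℝ :=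
  fun i j => if i ∈ D ∧ j ∈ D then M i j else 0

/-- The asymptotic variance `σ_i²` of the LSTD estimator. -/
def avar (P : Matrix (Fin n) (Fin n) ℝ) (Pr : Fin n → Measure (ℕ → Fin n))
    (D : Finset (Fin n)) (R : Fin n → ℝ) (μ : Fin n → ℝ) (τ : ℕ) (i : Fin n) : ℝ :=
  ∑ k ∈ D, (μ k)⁻¹ * ((((1 : Matrix (Fin n) (Fin n) ℝ) - zeroD D (stopMat P D ^ τ))⁻¹) i k) ^ 2 *
    ∫ ω, (∑ t ∈ Finset.range τ, RD D R (stopped D ω t)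
        + valueR Pr D R (stopped D ω τ) - valueR Pr D R k) ^ 2 ∂(Pr k)

/-- Mean exit time `E_i[T] = ∑_{t≥0} P_i[T > t]`, in `[0,∞]`. -/
def meanExit (Pr : Fin n → Measure (ℕ → Fin n)) (D : Finset (Fin n)) (i : Fin n) : ℝ≥0∞ :=
  ∑' t : ℕ, Pr i {ω | (t : ℕ∞) < exitT D ω}

/-- The event `T_ℓ^τ < min (T_k^τ, T_{Dᶜ∖{ℓ}}^τ)` for the `τ`-step chain. -/
def Qset (D : Finset (Fin n)) (k ℓ : Fin n) : Set (ℕ → Fin n) :=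
  {ω | hitT {ℓ} ω < min (hitT {k} ω) (hitT ((D : Set (Fin n))ᶜ \ {ℓ}) ω)}

/-- Green's function of the `τ`-step chain: `E_i[∑_{t=0}^{T^τ-1} 1{Y_t^τ = k}]`. -/
def greenY (PrY : Fin n → Measure (ℕ → Fin n)) (D : Finset (Fin n)) (i k : Fin n) : ℝ≥0∞ :=
  ∑' t : ℕ, PrY i {ω | (t : ℕ∞) < exitT D ω ∧ ω t = k}

/-- Green's function of the chain: `E_ℓ[∑_{t=0}^{T} 1{X_t = j}]` (the sum includes `t = T`). -/
def greenX (Pr : Fin n → Measure (ℕ → Fin n)) (D : Finset (Fin n)) (ℓ j : Fin n) : ℝ≥0∞ :=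
  ∑' t : ℕ, Pr ℓ {ω | (t : ℕ∞) ≤ exitT D ω ∧ ω t = j}


/-- The empirical transition matrix `S̃^t` built from `M` sampled trajectories. -/
def Stilde {n : ℕ} (D : Finset (Fin n)) {M : ℕ} (ωs : Fin M → ℕ → Fin n) (t : ℕ) :
    Matrix (Fin n) (Fin n) ℝ :=
  fun i j =>
    if (Finset.univ.filter fun ℓ : Fin M => ωs ℓ 0 = i).card = 0 then
      (if i = j then 1 else 0)
    else
      ((Finset.univ.filter fun ℓ : Fin M =>
          ωs ℓ 0 = i ∧ stopped D (ωs ℓ) t = j).card : ℝ) /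
        ((Finset.univ.filter fun ℓ : Fin M => ωs ℓ 0 = i).card : ℝ)

open scoped Classical in
/-- The LSTD estimator `ũ_M`: the unique solution of the empirical Bellman system
`(I - S̃^τ) ũ (i) = ∑_{t<τ} (S̃^t R_D)(i)` for `i ∈ D`, `ũ(i) = R(i)` for `i ∉ D`, when this
system is uniquely solvable, and `0` otherwise. -/
def lstd {n : ℕ} (D : Finset (Fin n)) (R : Fin n → ℝ) (τ : ℕ) {M : ℕ}
    (ωs : Fin M → ℕ → Fin n) : Fin n → ℝ :=
  let B : Matrix (Fin n) (Fin n) ℝ :=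
    fun i j => if i ∈ D then (if i = j then (1 : ℝ) else 0) - Stilde D ωs τ i j
      else if i = j then 1 else 0
  let b : Fin n → ℝ :=
    fun i => if i ∈ D then ∑ t ∈ Finset.range τ, ((Stilde D ωs t).mulVec (RD D R)) i
      else R i
  if IsUnit B.det then B⁻¹.mulVec b else 0

/-- The transition matrix of the chain killed on leaving `D`: the rows outside `D` vanish. -/
def killMat (P : Matrix (Fin n) (Fin n) ℝ) (D : Finset (Fin n)) : Matrix (Fin n) (Fin n) ℝ :=
  fun i j => if i ∈ D then P i j else 0

section Matrices

variable {P : Matrix (Fin n) (Fin n) ℝ} {D : Finset (Fin n)}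

lemma killMat_pow_nonneg (hP : IsStochastic P) (t : ℕ) (i j : Fin n) :
    0 ≤ (killMat P D ^ t) i j := by
  induction t generalizing i j with
  | zero => simp only [pow_zero, Matrix.one_apply]; split_ifs <;> simp
  | succ t ih =>
    rw [pow_succ', Matrix.mul_apply]
    refine Finset.sum_nonneg fun k _ => mul_nonneg ?_ (ih k j)
    unfold killMat
    split_ifs
    exacts [hP.1 i k, le_rfl]

lemma killMat_pow_succ_rowSum (t : ℕ) (i : Fin n) :
    ∑ j, (killMat P D ^ (t + 1)) i j = ∑ k, killMat P D i k * ∑ j, (killMat P D ^ t) k j := by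
  simp_rw [pow_succ', Matrix.mul_apply, Finset.mul_sum]
  exact Finset.sum_comm

lemma killMat_rowSum_le_one (hP : IsStochastic P) (i : Fin n) : ∑ j, killMat P D i j ≤ 1 := by
  unfold killMat
  split_ifs
  · exact (hP.2 i).le
  · simp

lemma killMat_nonneg (hP : IsStochastic P) (i j : Fin n) : 0 ≤ killMat P D i j := by
  simpa using killMat_pow_nonneg (D := D) hP 1 i j

lemma killMat_pow_rowSum_antitone (hP : IsStochastic P) (i : Fin n) :
    Antitone fun t => ∑ j, (killMat P D ^ t) i j := by
  refine antitone_nat_of_succ_le fun t => ?_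
  simp_rw [pow_succ, Matrix.mul_apply]
  rw [Finset.sum_comm]
  simp_rw [← Finset.mul_sum]
  exact Finset.sum_le_sum fun k _ =>
    mul_le_of_le_one_right (killMat_pow_nonneg hP t i k) (killMat_rowSum_le_one hP k)

lemma killMat_pow_rowSum_le_one (hP : IsStochastic P) (t : ℕ) (i : Fin n) :
    ∑ j, (killMat P D ^ t) i j ≤ 1 := by
  simpa [Matrix.one_apply] using killMat_pow_rowSum_antitone (D := D) hP i (Nat.zero_le t)

lemma pow_eq_zero_of_closed {C : Set (Fin n)} (hC : ∀ i ∈ C, ∀ j ∉ C, P i j = 0) (m : ℕ)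
    {i j : Fin n} (hi : i ∈ C) (hj : j ∉ C) : (P ^ m) i j = 0 := by
  induction m generalizing i with
  | zero => simp [show i ≠ j by rintro rfl; exact hj hi]
  | succ m ih =>
    rw [pow_succ', Matrix.mul_apply]
    refine Finset.sum_eq_zero fun k _ => ?_
    by_cases hk : k ∈ C
    · rw [ih hk, mul_zero]
    · rw [hC i hi k hk, zero_mul]

/-- From every state the killed chain loses mass after sufficiently many steps. -/
lemma exists_killMat_pow_rowSum_lt_one (hP : IsStochastic P) (hirr : IsIrreducible P)
    (hDne : D ≠ Finset.univ) (i : Fin n) : ∃ t, ∑ j, (killMat P D ^ t) i j < 1 := by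
  by_contra! hcon
  obtain ⟨j, hj⟩ : ∃ j, j ∉ D := by
    by_contra! h
    exact hDne (Finset.eq_univ_iff_forall.2 h)
  let C : Set (Fin n) := {k | ∀ t, 1 ≤ ∑ l, (killMat P D ^ t) k l}
  have hjC : j ∉ C := fun h => by
    have := h 1
    simp [killMat, hj] at this
    linarith
  have hclosed : ∀ k ∈ C, ∀ l ∉ C, P k l = 0 := by
    intro k hk l hl
    simp only [C, Set.mem_ofPred_eq, not_forall, not_le] at hl
    obtain ⟨t, ht⟩ := hl
    have hkD : k ∈ D := by
      by_contra h
      have := hk 1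
      simp [killMat, h] at this
      linarith
    have h1 := hk (t + 1)
    rw [killMat_pow_succ_rowSum] at h1
    by_contra hne
    have hpos : 0 < P k l := lt_of_le_of_ne (hP.1 k l) (Ne.symm hne)
    have : ∑ m, killMat P D k m * ∑ j, (killMat P D ^ t) m j < ∑ m, killMat P D k m := by
      refine Finset.sum_lt_sum (fun m _ => mul_le_of_le_one_right (killMat_nonneg hP k m)
        (killMat_pow_rowSum_le_one hP t m)) ⟨l, Finset.mem_univ _, ?_⟩
      exact mul_lt_of_lt_one_right (by simpa [killMat, hkD] using hpos) ht
    linarith [killMat_rowSum_le_one (D := D) hP k]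
  obtain ⟨m, -, hm⟩ := hirr i j
  exact hm.ne' (pow_eq_zero_of_closed hclosed m hcon hjC)

lemma abs_killMat_pow_mulVec_le (hP : IsStochastic P) (t : ℕ) {v : Fin n → ℝ} {c : ℝ}
    (hv : ∀ j, |v j| ≤ c) (i : Fin n) :
    |((killMat P D ^ t).mulVec v) i| ≤ (∑ j, (killMat P D ^ t) i j) * c := by
  simp only [Matrix.mulVec, dotProduct, Finset.sum_mul]
  refine (Finset.abs_sum_le_sum_abs _ _).trans (Finset.sum_le_sum fun j _ => ?_)
  rw [abs_mul, abs_of_nonneg (killMat_pow_nonneg hP t i j)]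
  exact mul_le_mul_of_nonneg_left (hv j) (killMat_pow_nonneg hP t i j)

lemma eq_zero_of_killMat_pow_mulVec_eq (hP : IsStochastic P) (hirr : IsIrreducible P)
    (hDne : D ≠ Finset.univ) {τ : ℕ} (hτ : 1 ≤ τ) {v : Fin n → ℝ}
    (hv : (killMat P D ^ τ).mulVec v = v) : v = 0 := by
  have hiter : ∀ N, (killMat P D ^ (τ * N)).mulVec v = v := by
    intro N
    induction N with
    | zero => simp
    | succ N ih => rw [Nat.mul_succ, pow_add, ← Matrix.mulVec_mulVec, hv, ih]
  rcases isEmpty_or_nonempty (Fin n) with h | h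
  · exact Subsingleton.elim _ _
  obtain ⟨i, hi⟩ := Finite.exists_max fun j => |v j|
  obtain ⟨t, ht⟩ := exists_killMat_pow_rowSum_lt_one hP hirr hDne i
  have h1 := abs_killMat_pow_mulVec_le (D := D) hP (τ * t) hi i
  rw [hiter] at h1
  have h2 : ∑ j, (killMat P D ^ (τ * t)) i j ≤ ∑ j, (killMat P D ^ t) i j :=
    killMat_pow_rowSum_antitone hP i (Nat.le_mul_of_pos_left t hτ)
  have h3 : |v i| = 0 := by nlinarith [abs_nonneg (v i)]
  ext j
  simpa using (hi j).trans h3.le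

lemma isUnit_one_sub_killMat (hP : IsStochastic P) (hirr : IsIrreducible P)
    (hDne : D ≠ Finset.univ) : IsUnit (1 - killMat P D) := by
  refine Matrix.mulVec_injective_iff_isUnit.1 ?_
  refine (injective_iff_map_eq_zero (Matrix.mulVecLin (1 - killMat P D))).2 fun v hv => ?_
  refine eq_zero_of_killMat_pow_mulVec_eq hP hirr hDne le_rfl (v := v) ?_
  rw [Matrix.mulVecLin_apply, Matrix.sub_mulVec, Matrix.one_mulVec, sub_eq_zero] at hv
  rw [pow_one, ← hv]

lemma zeroD_mulVec_of_notMem (M : Matrix (Fin n) (Fin n) ℝ) (v : Fin n → ℝ) {i : Fin n}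
    (hi : i ∉ D) : (zeroD D M).mulVec v i = 0 := by
  simp [zeroD, Matrix.mulVec, dotProduct, hi]

lemma zeroD_mulVec_of_mem (M : Matrix (Fin n) (Fin n) ℝ) {v : Fin n → ℝ}
    (hv : ∀ j ∉ D, v j = 0) {i : Fin n} (hi : i ∈ D) : (zeroD D M).mulVec v i = M.mulVec v i := by
  simp only [Matrix.mulVec, dotProduct, zeroD]
  refine Finset.sum_congr rfl fun j _ => ?_
  by_cases hj : j ∈ D
  · simp [hi, hj]
  · simp [hv j hj]

lemma stopMat_mulVec_of_notMem (v : Fin n → ℝ) {i : Fin n} (hi : i ∉ D) :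
    (stopMat P D).mulVec v i = v i := by
  simp [stopMat, Matrix.mulVec, dotProduct, hi]

lemma stopMat_mulVec_of_mem (v : Fin n → ℝ) {i : Fin n} (hi : i ∈ D) :
    (stopMat P D).mulVec v i = P.mulVec v i := by
  simp [stopMat, Matrix.mulVec, dotProduct, hi]

lemma killMat_mulVec_of_notMem (v : Fin n → ℝ) {i : Fin n} (hi : i ∉ D) :
    (killMat P D).mulVec v i = 0 := by
  simp [killMat, Matrix.mulVec, dotProduct, hi]

lemma killMat_mulVec_of_mem (v : Fin n → ℝ) {i : Fin n} (hi : i ∈ D) :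
    (killMat P D).mulVec v i = P.mulVec v i := by
  simp [killMat, Matrix.mulVec, dotProduct, hi]

lemma killMat_mulVec_eq_stopMat_mulVec {v : Fin n → ℝ} (hv : ∀ j ∉ D, v j = 0) :
    (killMat P D).mulVec v = (stopMat P D).mulVec v := by
  ext i
  by_cases hi : i ∈ D
  · rw [killMat_mulVec_of_mem v hi, stopMat_mulVec_of_mem v hi]
  · rw [killMat_mulVec_of_notMem v hi, stopMat_mulVec_of_notMem v hi, hv i hi]

lemma stopMat_pow_mulVec_of_notMem (t : ℕ) (v : Fin n → ℝ) {i : Fin n} (hi : i ∉ D) :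
    ((stopMat P D) ^ t).mulVec v i = v i := by
  induction t with
  | zero => simp
  | succ t ih => rw [pow_succ', ← Matrix.mulVec_mulVec, stopMat_mulVec_of_notMem _ hi, ih]

lemma killMat_pow_mulVec_eq_stopMat_pow_mulVec {v : Fin n → ℝ} (hv : ∀ j ∉ D, v j = 0) (t : ℕ) :
    (killMat P D ^ t).mulVec v = (stopMat P D ^ t).mulVec v := by
  induction t with
  | zero => simp
  | succ t ih =>
    rw [pow_succ', pow_succ', ← Matrix.mulVec_mulVec, ← Matrix.mulVec_mulVec, ih,
      killMat_mulVec_eq_stopMat_mulVec fun j hj => ?_]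
    rw [stopMat_pow_mulVec_of_notMem t v hj, hv j hj]

lemma isUnit_one_sub_zeroD_stopMat_pow (hP : IsStochastic P) (hirr : IsIrreducible P)
    (hDne : D ≠ Finset.univ) {τ : ℕ} (hτ : 1 ≤ τ) :
    IsUnit (1 - zeroD D (stopMat P D ^ τ)) := by
  refine Matrix.mulVec_injective_iff_isUnit.1 ?_
  refine (injective_iff_map_eq_zero
    (Matrix.mulVecLin (1 - zeroD D (stopMat P D ^ τ)))).2 fun v hv => ?_
  rw [Matrix.mulVecLin_apply, Matrix.sub_mulVec, Matrix.one_mulVec, sub_eq_zero] at hv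
  have hsupp : ∀ j ∉ D, v j = 0 := fun j hj => by rw [hv, zeroD_mulVec_of_notMem _ _ hj]
  refine eq_zero_of_killMat_pow_mulVec_eq hP hirr hDne hτ (v := v) ?_
  rw [killMat_pow_mulVec_eq_stopMat_pow_mulVec hsupp]
  ext i
  by_cases hi : i ∈ D
  · rw [← zeroD_mulVec_of_mem _ hsupp hi, ← hv]
  · rw [stopMat_pow_mulVec_of_notMem _ _ hi]

/-- The expected total reward collected by the killed chain converges to the solution of the
Bellman equation. -/
lemma exists_hasSum_killMat_pow_mulVec (hP : IsStochastic P) (hirr : IsIrreducible P)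
    (hDne : D ≠ Finset.univ) {R : Fin n → ℝ} (hR : ∀ i, 0 ≤ R i) :
    ∃ w : Fin n → ℝ, (∀ i, HasSum (fun t => (killMat P D ^ t).mulVec R i) (w i)) := by
  obtain ⟨x, hx⟩ := Matrix.mulVec_surjective_iff_isUnit.2
    (isUnit_one_sub_killMat (D := D) hP hirr hDne) R
  rw [Matrix.sub_mulVec, Matrix.one_mulVec] at hx
  have hpart : ∀ N, ∑ t ∈ range N, (killMat P D ^ t).mulVec R
      = x - (killMat P D ^ N).mulVec x := by
    intro N
    induction N with
    | zero => simp
    | succ N ih =>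
      rw [Finset.sum_range_succ, ih, ← hx, Matrix.mulVec_sub, Matrix.mulVec_mulVec, ← pow_succ]
      abel
  have hnn : ∀ t i, 0 ≤ (killMat P D ^ t).mulVec R i := fun t i => by
    simp only [Matrix.mulVec, dotProduct]
    exact Finset.sum_nonneg fun j _ => mul_nonneg (killMat_pow_nonneg hP t i j) (hR j)
  refine ⟨fun i => ∑' t, (killMat P D ^ t).mulVec R i, fun i => ?_⟩
  refine (summable_of_sum_range_le (c := x i + ∑ j, |x j|) (fun t => hnn t i)
    fun N => ?_).hasSum
  have h := congrFun (hpart N) i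
  rw [Finset.sum_apply, Pi.sub_apply] at h
  rw [h]
  have hb := abs_killMat_pow_mulVec_le (D := D) hP N (v := x) (c := ∑ j, |x j|)
    (fun j => Finset.single_le_sum (f := fun j => |x j|) (fun _ _ => abs_nonneg _)
      (Finset.mem_univ j)) i
  have h0 : 0 ≤ ∑ j, |x j| := Finset.sum_nonneg fun _ _ => abs_nonneg _
  have := mul_le_mul_of_nonneg_right (killMat_pow_rowSum_le_one (D := D) hP N i) h0
  linarith [neg_abs_le ((killMat P D ^ N).mulVec x i)]

end Matrices

section Markov

/-- `F` depends only on the first `t + 1` states of the path. -/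
def DependsUpTo {α : Type*} (F : (ℕ → Fin n) → α) (t : ℕ) : Prop :=
  ∀ ω ω' : ℕ → Fin n, (∀ s ≤ t, ω s = ω' s) → F ω = F ω'

/-- The path that follows `x` up to time `t` and stays constant afterwards. -/
def extendPath {t : ℕ} (x : Fin (t + 1) → Fin n) : ℕ → Fin n :=
  fun s => x (Fin.ofNat (t + 1) (min s t))

/-- The states of a path up to time `t`. -/
def restrictPath (t : ℕ) (ω : ℕ → Fin n) : Fin (t + 1) → Fin n := fun s => ω s

lemma extendPath_apply {t : ℕ} (x : Fin (t + 1) → Fin n) (s : Fin (t + 1)) :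
    extendPath x s = x s := by
  unfold extendPath
  congr 1
  ext
  simp [Nat.min_eq_left (Nat.lt_succ_iff.1 s.2)]

lemma extendPath_restrictPath {t : ℕ} (ω : ℕ → Fin n) {s : ℕ} (hs : s ≤ t) :
    extendPath (restrictPath t ω) s = ω s :=
  extendPath_apply (restrictPath t ω) ⟨s, Nat.lt_succ_iff.2 hs⟩

lemma measurable_restrictPath (t : ℕ) : Measurable (restrictPath (n := n) t) := by
  unfold restrictPath
  fun_prop

lemma DependsUpTo.eq_comp {α : Type*} {F : (ℕ → Fin n) → α} {t : ℕ} (hF : DependsUpTo F t) :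
    F = (fun x => F (extendPath x)) ∘ restrictPath t := by
  ext ω
  exact hF _ _ fun s hs => (extendPath_restrictPath ω hs).symm

lemma DependsUpTo.measurable {α : Type*} [MeasurableSpace α] {F : (ℕ → Fin n) → α} {t : ℕ}
    (hF : DependsUpTo F t) : Measurable F := by
  rw [hF.eq_comp]
  exact (measurable_of_finite _).comp (measurable_restrictPath t)

lemma DependsUpTo.exists_bound {F : (ℕ → Fin n) → ℝ} {t : ℕ} (hF : DependsUpTo F t) :
    ∃ C, ∀ ω, ‖F ω‖ ≤ C := by
  refine ⟨∑ x : Fin (t + 1) → Fin n, ‖F (extendPath x)‖, fun ω => ?_⟩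
  rw [congrFun hF.eq_comp ω]
  exact Finset.single_le_sum (f := fun x : Fin (t + 1) → Fin n => ‖F (extendPath x)‖)
    (fun _ _ => norm_nonneg _) (Finset.mem_univ _)

lemma DependsUpTo.memLp {F : (ℕ → Fin n) → ℝ} {t : ℕ} (hF : DependsUpTo F t) (p : ℝ≥0∞)
    (ν : Measure (ℕ → Fin n)) [IsFiniteMeasure ν] : MemLp F p ν := by
  obtain ⟨C, hC⟩ := hF.exists_bound
  exact MemLp.of_bound hF.measurable.aestronglyMeasurable C (ae_of_all _ hC)

lemma DependsUpTo.integrable {F : (ℕ → Fin n) → ℝ} {t : ℕ} (hF : DependsUpTo F t)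
    (ν : Measure (ℕ → Fin n)) [IsFiniteMeasure ν] : Integrable F ν :=
  memLp_one_iff_integrable.1 (hF.memLp 1 ν)

lemma preimage_restrictPath_singleton {t : ℕ} (x : Fin (t + 1) → Fin n) :
    restrictPath t ⁻¹' {x} = {ω | ∀ s ≤ t, ω s = extendPath x s} := by
  ext ω
  simp only [Set.mem_preimage, Set.mem_singleton_iff, Set.mem_ofPred_eq]
  constructor
  · rintro rfl s hs
    exact (extendPath_restrictPath ω hs).symm
  · intro h
    ext s
    rw [restrictPath, h s (Nat.lt_succ_iff.1 s.2), extendPath_apply]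

lemma DependsUpTo.integral_eq {F : (ℕ → Fin n) → ℝ} {t : ℕ} (hF : DependsUpTo F t)
    (ν : Measure (ℕ → Fin n)) [IsFiniteMeasure ν] :
    ∫ ω, F ω ∂ν = ∑ x : Fin (t + 1) → Fin n,
      (ν {ω | ∀ s ≤ t, ω s = extendPath x s}).toReal * F (extendPath x) := by
  conv_lhs => rw [hF.eq_comp]
  rw [show (∫ ω, ((fun x => F (extendPath x)) ∘ restrictPath t) ω ∂ν)
      = ∫ x, F (extendPath x) ∂(ν.map (restrictPath t)) from
    (integral_map (f := fun x => F (extendPath x)) (measurable_restrictPath t).aemeasurable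
      (measurable_of_finite _).aestronglyMeasurable).symm, integral_fintype .of_finite]
  refine Finset.sum_congr rfl fun x _ => ?_
  rw [measureReal_def, Measure.map_apply (measurable_restrictPath t) (measurableSet_singleton x),
    preimage_restrictPath_singleton, smul_eq_mul]

variable {P : Matrix (Fin n) (Fin n) ℝ} {D : Finset (Fin n)}
  {Pr : Fin n → Measure (ℕ → Fin n)}

lemma extendPath_snoc_of_le {t : ℕ} (x : Fin (t + 1) → Fin n) (j : Fin n) {s : ℕ} (hs : s ≤ t) :
    extendPath (Fin.snoc x j : Fin (t + 2) → Fin n) s = extendPath x s := by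
  have h1 := extendPath_apply (Fin.snoc x j : Fin (t + 2) → Fin n)
    (Fin.castSucc ⟨s, Nat.lt_succ_iff.2 hs⟩)
  have h2 := extendPath_apply x ⟨s, Nat.lt_succ_iff.2 hs⟩
  rw [Fin.snoc_castSucc] at h1
  exact h1.trans h2.symm

lemma extendPath_snoc_last {t : ℕ} (x : Fin (t + 1) → Fin n) (j : Fin n) :
    extendPath (Fin.snoc x j : Fin (t + 2) → Fin n) (t + 1) = j := by
  have h1 := extendPath_apply (Fin.snoc x j : Fin (t + 2) → Fin n) (Fin.last (t + 1))
  rwa [Fin.snoc_last] at h1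

/-- The Markov property at a fixed time. -/
lemma IsMarkovFamily.integral_mul_succ (hPr : IsMarkovFamily P Pr) (i : Fin n) {t : ℕ}
    {G : (ℕ → Fin n) → ℝ} (hG : DependsUpTo G t) (h : Fin n → ℝ) :
    ∫ ω, G ω * h (ω (t + 1)) ∂(Pr i) = ∫ ω, G ω * P.mulVec h (ω t) ∂(Pr i) := by
  have := hPr.1 i
  have h1 : DependsUpTo (fun ω => G ω * h (ω (t + 1))) (t + 1) := fun ω ω' hω => by
    simp only [hG ω ω' fun s hs => hω s (hs.trans t.le_succ), hω (t + 1) le_rfl]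
  have h2 : DependsUpTo (fun ω => G ω * P.mulVec h (ω t)) t := fun ω ω' hω => by
    simp only [hG ω ω' hω, hω t le_rfl]
  rw [h1.integral_eq, h2.integral_eq,
    ← (Fin.snocEquiv fun _ : Fin (t + 2) => Fin n).sum_comp, Fintype.sum_prod_type_right]
  refine Finset.sum_congr rfl fun x _ => ?_
  simp only [Matrix.mulVec, dotProduct, Finset.mul_sum]
  refine Finset.sum_congr rfl fun j _ => ?_
  simp only [Fin.snocEquiv, Equiv.coe_fn_mk]
  rw [hPr.2, hPr.2, Finset.prod_range_succ, extendPath_snoc_last,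
    extendPath_snoc_of_le x j (Nat.zero_le t), extendPath_snoc_of_le x j le_rfl,
    hG _ (extendPath x) fun s hs => extendPath_snoc_of_le x j hs,
    Finset.prod_congr rfl fun s hs => by
      rw [extendPath_snoc_of_le x j (Finset.mem_range.1 hs).le,
        extendPath_snoc_of_le x j (Finset.mem_range.1 hs)]]
  ring

lemma IsMarkovFamily.ae_apply_zero (hPr : IsMarkovFamily P Pr) (i : Fin n) :
    ∀ᵐ ω ∂(Pr i), ω 0 = i := by
  have := hPr.1 i
  have h := hPr.2 i 0 fun _ => i
  simp only [Nat.le_zero, forall_eq, range_zero, prod_empty, if_true, mul_one] at h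
  rw [ae_iff]
  have hm : MeasurableSet {ω : ℕ → Fin n | ω 0 = i} :=
    (measurable_pi_apply (X := fun _ : ℕ => Fin n) 0) (measurableSet_singleton i)
  have h1 : Pr i {ω | ω 0 = i} = 1 := by
    rw [← ENNReal.toReal_eq_one_iff, h]
  exact (prob_compl_eq_zero_iff hm).2 h1

lemma dependsUpTo_stopped (t : ℕ) : DependsUpTo (fun ω => stopped D ω t) t := by
  induction t with
  | zero => exact fun ω ω' h => h 0 le_rfl
  | succ t ih =>
    intro ω ω' h
    have := ih ω ω' fun s hs => h s (hs.trans t.le_succ)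
    simp only [stopped] at this ⊢
    rw [this, h (t + 1) le_rfl]

lemma stopped_eq_of_mem (ω : ℕ → Fin n) {t : ℕ} (h : stopped D ω t ∈ D) :
    stopped D ω t = ω t := by
  induction t with
  | zero => rfl
  | succ t ih =>
    simp only [stopped] at h ⊢
    split_ifs at h ⊢ with h'
    · rfl
    · exact absurd h h'

/-- The stopped chain has transition matrix `stopMat P D`. -/
lemma IsMarkovFamily.integral_stopped (hPr : IsMarkovFamily P Pr) (t : ℕ) (h : Fin n → ℝ)
    (i : Fin n) : ∫ ω, h (stopped D ω t) ∂(Pr i) = (stopMat P D ^ t).mulVec h i := by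
  have := hPr.1 i
  induction t generalizing h with
  | zero =>
    rw [pow_zero, Matrix.one_mulVec, integral_congr_ae (g := fun _ => h i), integral_const]
    · simp
    · filter_upwards [hPr.ae_apply_zero i] with ω hω
      simp [stopped, hω]
  | succ t ih =>
    have hs := dependsUpTo_stopped (D := D) t
    have hA : DependsUpTo (fun ω => if stopped D ω t ∈ D then (1 : ℝ) else 0) t :=
      fun ω ω' hω => by simp only [show stopped D ω t = stopped D ω' t from hs ω ω' hω]
    have hB : DependsUpTo (fun ω => if stopped D ω t ∈ D then 0 else h (stopped D ω t)) t :=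
      fun ω ω' hω => by simp only [show stopped D ω t = stopped D ω' t from hs ω ω' hω]
    have hA1 : DependsUpTo
        (fun ω => (if stopped D ω t ∈ D then (1 : ℝ) else 0) * h (ω (t + 1))) (t + 1) :=
      fun ω ω' hω => by
        simp only [hω (t + 1) le_rfl, hA ω ω' fun s hs => hω s (hs.trans t.le_succ)]
    have hA2 : DependsUpTo
        (fun ω => (if stopped D ω t ∈ D then (1 : ℝ) else 0) * P.mulVec h (ω t)) t :=
      fun ω ω' hω => by simp only [hω t le_rfl, hA ω ω' hω]
    calc ∫ ω, h (stopped D ω (t + 1)) ∂(Pr i)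
        = ∫ ω, ((if stopped D ω t ∈ D then (1 : ℝ) else 0) * h (ω (t + 1))
            + if stopped D ω t ∈ D then 0 else h (stopped D ω t)) ∂(Pr i) := by
          refine integral_congr_ae (ae_of_all _ fun ω => ?_)
          simp only [stopped]
          split_ifs <;> simp
      _ = ∫ ω, ((if stopped D ω t ∈ D then (1 : ℝ) else 0) * P.mulVec h (ω t)
            + if stopped D ω t ∈ D then 0 else h (stopped D ω t)) ∂(Pr i) := by
          rw [integral_add (hA1.integrable _) (hB.integrable _),
            integral_add (hA2.integrable _) (hB.integrable _), hPr.integral_mul_succ i hA h]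
      _ = ∫ ω, (stopMat P D).mulVec h (stopped D ω t) ∂(Pr i) := by
          refine integral_congr_ae (ae_of_all _ fun ω => ?_)
          by_cases hω : stopped D ω t ∈ D
          · beta_reduce
            rw [if_pos hω, if_pos hω, stopMat_mulVec_of_mem _ hω, stopped_eq_of_mem ω hω]
            simp
          · simp [hω, stopMat_mulVec_of_notMem]
      _ = (stopMat P D ^ (t + 1)).mulVec h i := by
          rw [ih, Matrix.mulVec_mulVec, ← pow_succ]

lemma natCast_le_exitT_iff (ω : ℕ → Fin n) (t : ℕ) :
    (t : ℕ∞) ≤ exitT D ω ↔ ∀ s < t, ω s ∈ D := by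
  simp only [exitT, le_iInf_iff, Nat.cast_le]
  constructor
  · intro h s hs
    by_contra hsD
    exact absurd (h s hsD) (not_le.2 hs)
  · intro h s hsD
    by_contra! hs
    exact hsD (h s hs)

lemma dependsUpTo_le_exitT (t : ℕ) {s : ℕ} (hts : t ≤ s + 1) :
    DependsUpTo (fun ω => (t : ℕ∞) ≤ exitT D ω) s := by
  intro ω ω' h
  simp only [natCast_le_exitT_iff, eq_iff_iff]
  exact forall₂_congr fun r hr => by rw [h r (by omega)]

open scoped Classical in
lemma IsMarkovFamily.integral_killed (hPr : IsMarkovFamily P Pr) (t : ℕ) (h : Fin n → ℝ)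
    (i : Fin n) :
    ∫ ω, (if (t : ℕ∞) ≤ exitT D ω then 1 else 0) * h (ω t) ∂(Pr i)
      = (killMat P D ^ t).mulVec h i := by
  have := hPr.1 i
  induction t generalizing h with
  | zero =>
    rw [pow_zero, Matrix.one_mulVec, integral_congr_ae (g := fun _ => h i), integral_const]
    · simp
    · filter_upwards [hPr.ae_apply_zero i] with ω hω
      simp [hω]
  | succ t ih =>
    have hA : DependsUpTo (fun ω => if ((t + 1 : ℕ) : ℕ∞) ≤ exitT D ω then (1 : ℝ) else 0) t :=
      fun ω ω' hω => by
        simp only [show (((t + 1 : ℕ) : ℕ∞) ≤ exitT D ω) = (((t + 1 : ℕ) : ℕ∞) ≤ exitT D ω') from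
          dependsUpTo_le_exitT (t + 1) le_rfl ω ω' hω]
    rw [hPr.integral_mul_succ i hA h, pow_succ, ← Matrix.mulVec_mulVec, ← ih]
    refine integral_congr_ae (ae_of_all _ fun ω => ?_)
    have hstep : ((t + 1 : ℕ) : ℕ∞) ≤ exitT D ω ↔ (t : ℕ∞) ≤ exitT D ω ∧ ω t ∈ D := by
      simp only [natCast_le_exitT_iff, Nat.lt_succ_iff_lt_or_eq]
      exact ⟨fun H => ⟨fun s hs => H s (.inl hs), H t (.inr rfl)⟩,
        fun H s hs => hs.elim (H.1 s) fun e => e ▸ H.2⟩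
    beta_reduce
    rw [if_congr hstep rfl rfl]
    by_cases hω : ω t ∈ D
    · rw [killMat_mulVec_of_mem _ hω]
      simp [hω]
    · rw [killMat_mulVec_of_notMem _ hω]
      simp [hω]

lemma valueE_eq_tsum (hPr : IsMarkovFamily P Pr) {R : Fin n → ℝ} (hR : ∀ i, 0 ≤ R i)
    (i : Fin n) : valueE Pr D R i = ∑' t, ENNReal.ofReal ((killMat P D ^ t).mulVec R i) := by
  classical
  have := hPr.1 i
  refine tsum_congr fun t => ?_
  have hd : DependsUpTo
      (fun ω => (if (t : ℕ∞) ≤ exitT D ω then (1 : ℝ) else 0) * R (ω t)) t :=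
    fun ω ω' hω => by
      simp only [hω t le_rfl, show ((t : ℕ∞) ≤ exitT D ω) = ((t : ℕ∞) ≤ exitT D ω') from
        dependsUpTo_le_exitT t t.le_succ ω ω' hω]
  rw [← hPr.integral_killed t R i, ofReal_integral_eq_lintegral_ofReal (hd.integrable _)
    (ae_of_all _ fun ω => mul_nonneg (by split_ifs <;> simp) (hR _))]
  refine lintegral_congr fun ω => ?_
  by_cases hω : (t : ℕ∞) ≤ exitT D ω <;> simp [Set.indicator, hω]

/-- The value function solves the one-step Bellman equation. -/
lemma valueR_eq_add_killMat_mulVec (hP : IsStochastic P) (hirr : IsIrreducible P)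
    (hDne : D ≠ Finset.univ) (hPr : IsMarkovFamily P Pr) {R : Fin n → ℝ} (hR : ∀ i, 0 ≤ R i) :
    valueR Pr D R = R + (killMat P D).mulVec (valueR Pr D R) := by
  obtain ⟨w, hw⟩ := exists_hasSum_killMat_pow_mulVec (D := D) hP hirr hDne hR
  have hnn : ∀ t i, 0 ≤ (killMat P D ^ t).mulVec R i := fun t i => by
    simp only [Matrix.mulVec, dotProduct]
    exact Finset.sum_nonneg fun j _ => mul_nonneg (killMat_pow_nonneg hP t i j) (hR j)
  have huw : valueR Pr D R = w := by
    ext i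
    rw [valueR, valueE_eq_tsum hPr hR, ← ENNReal.ofReal_tsum_of_nonneg (fun t => hnn t i)
      (hw i).summable, (hw i).tsum_eq, ENNReal.toReal_ofReal ((hw i).nonneg fun t => hnn t i)]
  rw [huw]
  ext i
  refine (hw i).unique ?_
  have h1 : HasSum (fun t => (killMat P D ^ (t + 1)).mulVec R i)
      ((killMat P D).mulVec w i) := by
    simp_rw [pow_succ', ← Matrix.mulVec_mulVec]
    simp only [Matrix.mulVec, dotProduct]
    exact hasSum_sum fun j _ => (hw j).mul_left _
  simpa [add_comm] using (hasSum_nat_add_iff (f := fun t => (killMat P D ^ t).mulVec R i) 1).1 h1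

lemma valueR_of_notMem (hP : IsStochastic P) (hirr : IsIrreducible P)
    (hDne : D ≠ Finset.univ) (hPr : IsMarkovFamily P Pr) {R : Fin n → ℝ} (hR : ∀ i, 0 ≤ R i)
    {i : Fin n} (hi : i ∉ D) : valueR Pr D R i = R i := by
  have h := congrFun (valueR_eq_add_killMat_mulVec (D := D) hP hirr hDne hPr hR) i
  rwa [Pi.add_apply, killMat_mulVec_of_notMem _ hi, add_zero] at h

/-- The value function solves the `τ`-step Bellman equation. -/
lemma valueR_eq_sum_add_stopMat_pow_mulVec (hP : IsStochastic P) (hirr : IsIrreducible P)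
    (hDne : D ≠ Finset.univ) (hPr : IsMarkovFamily P Pr) {R : Fin n → ℝ} (hR : ∀ i, 0 ≤ R i)
    (τ : ℕ) :
    valueR Pr D R = ∑ t ∈ range τ, (stopMat P D ^ t).mulVec (RD D R)
      + (stopMat P D ^ τ).mulVec (valueR Pr D R) := by
  have hone : valueR Pr D R = RD D R + (stopMat P D).mulVec (valueR Pr D R) := by
    ext i
    by_cases hi : i ∈ D
    · have h := congrFun (valueR_eq_add_killMat_mulVec (D := D) hP hirr hDne hPr hR) i
      rw [Pi.add_apply, killMat_mulVec_of_mem _ hi] at h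
      rw [Pi.add_apply, stopMat_mulVec_of_mem _ hi, RD, if_pos hi]
      exact h
    · rw [Pi.add_apply, stopMat_mulVec_of_notMem _ hi, RD, if_neg hi, zero_add]
  induction τ with
  | zero => simp
  | succ τ ih =>
    rw [Finset.sum_range_succ, pow_succ, ← Matrix.mulVec_mulVec, add_assoc, ← Matrix.mulVec_add,
      ← hone]
    exact ih

end Markov

section Empirical

variable {D : Finset (Fin n)}

/-- The number of sampled trajectories started at `k`. -/
def startCount {M : ℕ} (ωs : Fin M → ℕ → Fin n) (k : Fin n) : ℕ :=
  (Finset.univ.filter fun ℓ : Fin M => ωs ℓ 0 = k).card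

/-- The `τ`-step Bellman residual of `u` along a path. -/
def residual (D : Finset (Fin n)) (R u : Fin n → ℝ) (τ : ℕ) (ω : ℕ → Fin n) : ℝ :=
  ∑ t ∈ range τ, RD D R (stopped D ω t) + u (stopped D ω τ) - u (ω 0)

/-- A path functional restricted to the paths started at `k`. -/
def startingAt (k : Fin n) (F : (ℕ → Fin n) → ℝ) (ω : ℕ → Fin n) : ℝ :=
  if ω 0 = k then F ω else 0

lemma startCount_eq_sum {M : ℕ} (ωs : Fin M → ℕ → Fin n) (k : Fin n) :
    (startCount ωs k : ℝ) = ∑ ℓ, startingAt k (fun _ => 1) (ωs ℓ) := by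
  simp [startCount, startingAt]

lemma Stilde_mulVec {M : ℕ} {ωs : Fin M → ℕ → Fin n} {k : Fin n} (hk : startCount ωs k ≠ 0)
    (t : ℕ) (h : Fin n → ℝ) :
    (Stilde D ωs t).mulVec h k
      = (∑ ℓ, startingAt k (fun ω => h (stopped D ω t)) (ωs ℓ)) / startCount ωs k := by
  have hk' : ¬ (Finset.univ.filter fun ℓ : Fin M => ωs ℓ 0 = k).card = 0 := hk
  simp only [Matrix.mulVec, dotProduct, Stilde, if_neg hk', div_mul_eq_mul_div]
  rw [← Finset.sum_div, startCount]
  congr 1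
  simp only [Finset.card_filter, Nat.cast_sum, Finset.sum_mul]
  rw [Finset.sum_comm]
  refine Finset.sum_congr rfl fun ℓ _ => ?_
  by_cases hℓ : ωs ℓ 0 = k <;> simp [startingAt, hℓ]

lemma one_sub_zeroD_mulVec_of_mem (A : Matrix (Fin n) (Fin n) ℝ) {v : Fin n → ℝ}
    (hv : ∀ j ∉ D, v j = 0) {i : Fin n} (hi : i ∈ D) :
    (1 - zeroD D A).mulVec v i = v i - A.mulVec v i := by
  rw [Matrix.sub_mulVec, Matrix.one_mulVec, Pi.sub_apply, zeroD_mulVec_of_mem A hv hi]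

/-- The error of the estimator, expressed through the empirical Bellman residuals. -/
lemma lstd_sub_eq {M : ℕ} {ωs : Fin M → ℕ → Fin n} {R u : Fin n → ℝ} {τ : ℕ}
    (hu : ∀ j ∉ D, u j = R j) (hcount : ∀ k ∈ D, startCount ωs k ≠ 0)
    (hA : IsUnit (1 - zeroD D (Stilde D ωs τ))) (i : Fin n) :
    lstd D R τ ωs i - u i = ∑ k ∈ D, (1 - zeroD D (Stilde D ωs τ))⁻¹ i k *
      ((∑ ℓ, startingAt k (residual D R u τ) (ωs ℓ)) / startCount ωs k) := by
  set S := Stilde D ωs τ with hS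
  set B : Matrix (Fin n) (Fin n) ℝ :=
    fun i j => if i ∈ D then (if i = j then (1 : ℝ) else 0) - S i j
      else if i = j then 1 else 0 with hB
  set b : Fin n → ℝ :=
    fun i => if i ∈ D then ∑ t ∈ Finset.range τ, ((Stilde D ωs t).mulVec (RD D R)) i
      else R i with hb
  have hBmem : ∀ v : Fin n → ℝ, ∀ k ∈ D, B.mulVec v k = v k - S.mulVec v k := by
    intro v k hk
    simp [hB, Matrix.mulVec, dotProduct, hk, sub_mul, Finset.sum_sub_distrib]
  have hBnot : ∀ v : Fin n → ℝ, ∀ k ∉ D, B.mulVec v k = v k := by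
    intro v k hk
    simp [hB, Matrix.mulVec, dotProduct, hk]
  have hinj := Matrix.mulVec_injective_iff_isUnit.2 hA
  have hBunit : IsUnit B := by
    refine Matrix.mulVec_injective_iff_isUnit.1 ?_
    refine (injective_iff_map_eq_zero (Matrix.mulVecLin B)).2 fun v hv => ?_
    rw [Matrix.mulVecLin_apply] at hv
    have hv0 : ∀ j ∉ D, v j = 0 := fun j hj => by rw [← hBnot v j hj, hv, Pi.zero_apply]
    refine hinj ?_
    rw [Matrix.mulVec_zero]
    ext k
    by_cases hk : k ∈ D
    · rw [one_sub_zeroD_mulVec_of_mem S hv0 hk, ← hBmem v k hk, hv]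
    · rw [Matrix.sub_mulVec, Matrix.one_mulVec, Pi.sub_apply, zeroD_mulVec_of_notMem S v hk,
        hv0 k hk, sub_zero, Pi.zero_apply]
  have hBdet : IsUnit B.det := (Matrix.isUnit_iff_isUnit_det B).1 hBunit
  have hlstd : lstd D R τ ωs = B⁻¹.mulVec b := if_pos hBdet
  have hsol : B.mulVec (lstd D R τ ωs) = b := by
    rw [hlstd, Matrix.mulVec_mulVec, Matrix.mul_nonsing_inv _ hBdet, Matrix.one_mulVec]
  set v := lstd D R τ ωs - u with hv
  have hv0 : ∀ j ∉ D, v j = 0 := fun j hj => by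
    rw [hv, Pi.sub_apply, hu j hj, ← hBnot (lstd D R τ ωs) j hj, hsol, hb]
    simp [hj]
  set W : Fin n → ℝ := fun k => if k ∈ D then
    (∑ ℓ, startingAt k (residual D R u τ) (ωs ℓ)) / startCount ωs k else 0 with hW
  have hAv : (1 - zeroD D S).mulVec v = W := by
    ext k
    by_cases hk : k ∈ D
    · have hc : (startCount ωs k : ℝ) ≠ 0 := Nat.cast_ne_zero.2 (hcount k hk)
      rw [one_sub_zeroD_mulVec_of_mem S hv0 hk, ← hBmem v k hk, hv, Matrix.mulVec_sub, hsol,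
        Pi.sub_apply, hBmem u k hk, hb, hW]
      simp only [if_pos hk]
      rw [hS, Stilde_mulVec (hcount k hk), Finset.sum_congr rfl fun t _ =>
        Stilde_mulVec (D := D) (hcount k hk) t (RD D R), ← Finset.sum_div, Finset.sum_comm,
        ← mul_div_cancel_right₀ (u k) hc, mul_comm, startCount_eq_sum, Finset.sum_mul,
        ← sub_div, ← sub_div]
      congr 1
      rw [← Finset.sum_sub_distrib, ← Finset.sum_sub_distrib]
      refine Finset.sum_congr rfl fun ℓ _ => ?_
      by_cases hℓ : ωs ℓ 0 = k
      · simp only [startingAt, residual, hℓ, if_true]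
        ring
      · simp [startingAt, hℓ]
    · rw [Matrix.sub_mulVec, Matrix.one_mulVec, Pi.sub_apply, zeroD_mulVec_of_notMem S v hk,
        hv0 k hk, sub_zero, hW]
      simp [hk]
  have hfin : v = (1 - zeroD D S)⁻¹.mulVec W := by
    rw [← hAv, Matrix.mulVec_mulVec,
      Matrix.nonsing_inv_mul _ ((Matrix.isUnit_iff_isUnit_det _).1 hA), Matrix.one_mulVec]
  have := congrFun hfin i
  rw [hv, Pi.sub_apply] at this
  rw [this]
  simp [Matrix.mulVec, dotProduct, hW, Finset.sum_ite_mem]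

lemma dependsUpTo_residual (R u : Fin n → ℝ) (τ : ℕ) : DependsUpTo (residual D R u τ) τ := by
  intro ω ω' h
  have hs : ∀ t ≤ τ, stopped D ω t = stopped D ω' t := fun t ht =>
    dependsUpTo_stopped t ω ω' fun s hst => h s (hst.trans ht)
  unfold residual
  rw [hs τ le_rfl, h 0 τ.zero_le, Finset.sum_congr rfl fun t ht => by
    rw [hs t (Finset.mem_range.1 ht).le]]

lemma DependsUpTo.startingAt {F : (ℕ → Fin n) → ℝ} {t : ℕ} (hF : DependsUpTo F t) (k : Fin n) :
    DependsUpTo (startingAt k F) t := fun ω ω' h => by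
  simp only [RareTD.startingAt, h 0 t.zero_le, hF ω ω' h]

/-- A function of finitely many paths that only depends on their states up to time `t` is
measurable. -/
lemma measurable_of_forall_eq_upTo {α : Type*} [MeasurableSpace α] {M t : ℕ}
    {F : (Fin M → ℕ → Fin n) → α}
    (hF : ∀ ωs ωs', (∀ ℓ, ∀ s ≤ t, ωs ℓ s = ωs' ℓ s) → F ωs = F ωs') : Measurable F := by
  have : F = (fun x : Fin M → Fin (t + 1) → Fin n => F fun ℓ => extendPath (x ℓ)) ∘
      fun ωs ℓ => restrictPath t (ωs ℓ) := by
    ext ωs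
    exact hF _ _ fun ℓ s hs => (extendPath_restrictPath (ωs ℓ) hs).symm
  rw [this]
  exact (measurable_of_finite _).comp (measurable_pi_lambda _ fun ℓ =>
    (measurable_restrictPath t).comp (measurable_pi_apply ℓ))

lemma startCount_congr {M : ℕ} {ωs ωs' : Fin M → ℕ → Fin n} (h : ∀ ℓ, ωs ℓ 0 = ωs' ℓ 0)
    (k : Fin n) : startCount ωs k = startCount ωs' k := by
  simp only [startCount, h]

lemma Stilde_congr {M t : ℕ} {ωs ωs' : Fin M → ℕ → Fin n}
    (h : ∀ ℓ, ∀ s ≤ t, ωs ℓ s = ωs' ℓ s) : Stilde D ωs t = Stilde D ωs' t := by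
  ext i j
  have hs : ∀ ℓ, stopped D (ωs ℓ) t = stopped D (ωs' ℓ) t := fun ℓ =>
    dependsUpTo_stopped t _ _ (h ℓ)
  simp only [Stilde, hs, fun ℓ => h ℓ 0 t.zero_le]

lemma lstd_congr {M τ : ℕ} {ωs ωs' : Fin M → ℕ → Fin n} (R : Fin n → ℝ)
    (h : ∀ ℓ, ∀ s ≤ τ, ωs ℓ s = ωs' ℓ s) : lstd D R τ ωs = lstd D R τ ωs' := by
  have hlt : ∀ i, ∑ t ∈ range τ, (Stilde D ωs t).mulVec (RD D R) i
      = ∑ t ∈ range τ, (Stilde D ωs' t).mulVec (RD D R) i := fun i =>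
    Finset.sum_congr rfl fun t ht => by
      rw [Stilde_congr fun ℓ s hs => h ℓ s (hs.trans (Finset.mem_range.1 ht).le)]
  simp only [lstd, hlt]
  rw [Stilde_congr h]

lemma measurable_lstd (R : Fin n → ℝ) (τ M : ℕ) (i : Fin n) :
    Measurable fun ωs : Fin M → ℕ → Fin n => lstd D R τ ωs i :=
  measurable_of_forall_eq_upTo fun _ _ h => by rw [lstd_congr R h]

end Empirical

section Probability

open ProbabilityTheory Topology

lemma tendstoInMeasure_mul_of_variance_le {Ω : Type*} [MeasurableSpace Ω] {ν : Measure Ω}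
    [IsProbabilityMeasure ν] {C V : ℕ → Ω → ℝ} (hC : TendstoInMeasure ν C atTop fun _ => 0)
    (hV : ∀ M, MemLp (V M) 2 ν) (h0 : ∀ M, ν[V M] = 0) {K : ℝ} (hK : ∀ M, Var[V M; ν] ≤ K) :
    TendstoInMeasure ν (fun M ω => C M ω * V M ω) atTop fun _ => 0 := by
  rw [tendstoInMeasure_iff_norm] at hC ⊢
  simp only [sub_zero] at hC ⊢
  intro ε hε
  rw [ENNReal.tendsto_nhds_zero]
  intro η hη
  have hη2 : 0 < η / 2 := ENNReal.half_pos hη.ne'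
  have hlim : Tendsto (fun c : ℝ => ENNReal.ofReal (K / c ^ 2)) atTop (𝓝 0) := by
    rw [← ENNReal.ofReal_zero]
    exact ENNReal.tendsto_ofReal (tendsto_const_nhds.div_atTop (tendsto_pow_atTop two_ne_zero))
  obtain ⟨c, hc, hcpos⟩ :=
    ((hlim.eventually_le_const hη2).and (eventually_gt_atTop 0)).exists
  filter_upwards [(hC (ε / c) (div_pos hε hcpos)).eventually_le_const hη2] with M hM
  have hVc : ν {ω | c ≤ |V M ω|} ≤ η / 2 := by
    have := meas_ge_le_variance_div_sq (hV M) hcpos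
    rw [h0 M] at this
    simp only [sub_zero] at this
    refine this.trans (le_trans (ENNReal.ofReal_le_ofReal ?_) hc)
    exact div_le_div_of_nonneg_right (hK M) (sq_nonneg c)
  calc ν {ω | ε ≤ ‖C M ω * V M ω‖}
      ≤ ν ({ω | ε / c ≤ ‖C M ω‖} ∪ {ω | c ≤ |V M ω|}) := by
        refine measure_mono fun ω hω => ?_
        by_contra hcon
        simp only [Set.mem_union, Set.mem_ofPred_eq, not_or, not_le, Real.norm_eq_abs] at hcon hω
        rw [abs_mul] at hω
        have h1 : |C M ω| * |V M ω| ≤ |C M ω| * c :=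
          mul_le_mul_of_nonneg_left hcon.2.le (abs_nonneg _)
        have h2 := (lt_div_iff₀ hcpos).1 hcon.1
        linarith
    _ ≤ ν {ω | ε / c ≤ ‖C M ω‖} + ν {ω | c ≤ |V M ω|} := measure_union_le _ _
    _ ≤ η / 2 + η / 2 := add_le_add hM hVc
    _ = η := ENNReal.add_halves η

lemma tendstoInDistribution_add_sum {Ω Ω' ι : Type*} [MeasurableSpace Ω] [MeasurableSpace Ω']
    {ν : Measure Ω} [IsProbabilityMeasure ν] {ν' : Measure Ω'} [IsProbabilityMeasure ν']
    {X : ℕ → Ω → ℝ} {Z : Ω' → ℝ} (hX : TendstoInDistribution X atTop Z (fun _ => ν) ν')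
    (s : Finset ι) {Y : ι → ℕ → Ω → ℝ}
    (hY : ∀ k ∈ s, TendstoInMeasure ν (Y k) atTop fun _ => 0)
    (hYm : ∀ k ∈ s, ∀ M, AEMeasurable (Y k M) ν) :
    TendstoInDistribution (fun M ω => X M ω + ∑ k ∈ s, Y k M ω) atTop Z (fun _ => ν) ν' := by
  classical
  induction s using Finset.induction_on with
  | empty => simpa using hX
  | insert k s hk ih =>
    have h := (ih (fun l hl => hY l (Finset.mem_insert_of_mem hl))
      fun l hl => hYm l (Finset.mem_insert_of_mem hl)).add_of_tendstoInMeasure_const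
        (hY k (Finset.mem_insert_self k s)) (hYm k (Finset.mem_insert_self k s))
    convert! h using 2 with M
    · ext ω
      rw [Finset.sum_insert hk, Pi.add_apply]
      ring
    · simp

lemma tendsto_matrix_inv {A : ℕ → Matrix (Fin n) (Fin n) ℝ} {B : Matrix (Fin n) (Fin n) ℝ}
    (hB : IsUnit B) (h : Tendsto A atTop (𝓝 B)) : Tendsto (fun M => (A M)⁻¹) atTop (𝓝 B⁻¹) := by
  simp only [Matrix.inv_def, Ring.inverse_eq_inv']
  refine Tendsto.smul (Tendsto.inv₀ ?_ ?_) ?_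
  · exact ((continuous_id.matrix_det).tendsto B).comp h
  · exact ((Matrix.isUnit_iff_isUnit_det B).1 hB).ne_zero
  · exact ((continuous_id.matrix_adjugate).tendsto B).comp h

lemma eventually_isUnit_matrix {A : ℕ → Matrix (Fin n) (Fin n) ℝ} {B : Matrix (Fin n) (Fin n) ℝ}
    (hB : IsUnit B) (h : Tendsto A atTop (𝓝 B)) : ∀ᶠ M in atTop, IsUnit (A M) := by
  have hdet : Tendsto (fun M => (A M).det) atTop (𝓝 B.det) :=
    ((continuous_id.matrix_det).tendsto B).comp h
  filter_upwards [hdet.eventually_ne ((Matrix.isUnit_iff_isUnit_det B).1 hB).ne_zero] with M hM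
  exact (Matrix.isUnit_iff_isUnit_det _).2 (isUnit_iff_ne_zero.2 hM)

section Samples

variable {E : Type*} [MeasurableSpace E] {ν : Measure E} [IsProbabilityMeasure ν]
  {F : E → ℝ}

/-- The law of an infinite sequence of independent samples from `ν`. -/
abbrev samples (ν : Measure E) [IsProbabilityMeasure ν] : Measure (ℕ → E) :=
  Measure.infinitePi fun _ : ℕ => ν

lemma iIndepFun_samples (hF : Measurable F) :
    iIndepFun (fun (ℓ : ℕ) (ω : ℕ → E) => F (ω ℓ)) (samples ν) :=
  iIndepFun_infinitePi fun _ => hF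

lemma identDistrib_samples (hF : Measurable F) (ℓ : ℕ) :
    IdentDistrib (fun ω : ℕ → E => F (ω ℓ)) F (samples ν) ν := by
  refine ⟨(hF.comp (measurable_pi_apply ℓ)).aemeasurable, hF.aemeasurable, ?_⟩
  rw [← Function.comp_def F, ← Measure.map_map hF (measurable_pi_apply ℓ),
    Measure.infinitePi_map_eval]

lemma identDistrib_samples_zero (hF : Measurable F) (ℓ : ℕ) :
    IdentDistrib (fun ω : ℕ → E => F (ω ℓ)) (fun ω => F (ω 0)) (samples ν) (samples ν) :=
  (identDistrib_samples hF ℓ).trans (identDistrib_samples hF 0).symm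

lemma ae_tendsto_average (hF : Measurable F) (hint : Integrable F ν) :
    ∀ᵐ ω ∂(samples ν), Tendsto (fun M : ℕ => (∑ ℓ ∈ range M, F (ω ℓ)) / M) atTop
      (𝓝 (∫ x, F x ∂ν)) := by
  have h := strong_law_ae_real (μ := samples ν) (fun ℓ ω => F (ω ℓ))
    ((identDistrib_samples hF 0).integrable_iff.2 hint)
    (fun i j hij => (iIndepFun_samples hF).indepFun hij) (identDistrib_samples_zero hF)
  have hmean : ∫ ω, F (ω 0) ∂(samples ν) = ∫ x, F x ∂ν := (identDistrib_samples hF 0).integral_eq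
  rwa [hmean] at h

lemma memLp_scaledSum (hF : Measurable F) (hL : MemLp F 2 ν) (M : ℕ) :
    MemLp (fun ω => (√M)⁻¹ * ∑ ℓ ∈ range M, F (ω ℓ)) 2 (samples ν) :=
  (memLp_finsetSum (range M) fun ℓ _ =>
    (identDistrib_samples hF ℓ).memLp_iff.2 hL).const_mul _

lemma integral_scaledSum (hF : Measurable F) (hL : Integrable F ν) (h0 : ∫ x, F x ∂ν = 0)
    (M : ℕ) : ∫ ω, (√M)⁻¹ * ∑ ℓ ∈ range M, F (ω ℓ) ∂(samples ν) = 0 := by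
  rw [integral_const_mul, integral_finsetSum _ fun ℓ _ =>
    (identDistrib_samples hF ℓ).integrable_iff.2 hL]
  simp [(identDistrib_samples (ν := ν) hF _).integral_eq, h0]

lemma variance_scaledSum_le (hF : Measurable F) (hL : MemLp F 2 ν) (M : ℕ) :
    Var[fun ω => (√M)⁻¹ * ∑ ℓ ∈ range M, F (ω ℓ); samples ν] ≤ Var[F; ν] := by
  have hsum : (fun ω : ℕ → E => ∑ ℓ ∈ range M, F (ω ℓ)) = ∑ ℓ ∈ range M, fun ω => F (ω ℓ) := by
    ext ω
    simp
  rw [variance_const_mul, hsum, IndepFun.variance_sum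
    (fun ℓ _ => (identDistrib_samples hF ℓ).memLp_iff.2 hL)
    (fun i _ j _ hij => (iIndepFun_samples hF).indepFun hij)]
  simp only [(identDistrib_samples (ν := ν) hF _).variance_eq, sum_const, card_range,
    nsmul_eq_mul, inv_pow, Real.sq_sqrt (Nat.cast_nonneg M)]
  rcases M.eq_zero_or_pos with rfl | hM
  · simp [variance_nonneg]
  · rw [inv_mul_cancel_left₀ (by positivity)]

lemma tendstoInDistribution_scaledSum (hF : Measurable F) (hL : MemLp F 2 ν)
    (h0 : ∫ x, F x ∂ν = 0) :
    TendstoInDistribution (fun (M : ℕ) (ω : ℕ → E) => (√M)⁻¹ * ∑ ℓ ∈ range M, F (ω ℓ)) atTop id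
      (fun _ => samples ν) (gaussianReal 0 (∫ x, F x ^ 2 ∂ν).toNNReal) := by
  have hvar : Var[fun ω : ℕ → E => F (ω 0); samples ν] = ∫ x, F x ^ 2 ∂ν := by
    rw [(identDistrib_samples hF 0).variance_eq,
      variance_of_integral_eq_zero hF.aemeasurable h0]
  have h := tendstoInDistribution_inv_sqrt_mul_sum_sub (P := samples ν)
    (X := fun ℓ ω => F (ω ℓ)) (Y := id) (P' := gaussianReal 0 (∫ x, F x ^ 2 ∂ν).toNNReal)
    (by rw [hvar]; exact HasLaw.id) ((identDistrib_samples hF 0).memLp_iff.2 hL)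
    (iIndepFun_samples hF) (identDistrib_samples_zero hF)
  simpa [(identDistrib_samples (ν := ν) hF 0).integral_eq, h0] using h

lemma integral_pi_eq_integral_samples (M : ℕ) {G : (Fin M → E) → ℝ} (hG : Measurable G) :
    ∫ x, G x ∂(Measure.pi fun _ : Fin M => ν)
      = ∫ ω, G (fun ℓ => ω ℓ) ∂(samples ν) := by
  have h := Measure.map_infinitePi_infinitePi_of_inj (P := fun _ : ℕ => ν)
    (Fin.val_injective (n := M))
  rw [Measure.infinitePi_eq_pi (ι := Fin M)] at h
  rw [← h, integral_map (measurable_pi_lambda _ fun ℓ => measurable_pi_apply _).aemeasurable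
    hG.aestronglyMeasurable]

end Samples

section Limit

variable {D : Finset (Fin n)} {P : Matrix (Fin n) (Fin n) ℝ}
  {Pr : Fin n → Measure (ℕ → Fin n)} {μ : Fin n → ℝ} {ν : Measure (ℕ → Fin n)}

/-- The first `M` terms of a sequence of samples. -/
def firstSamples {E : Type*} (ω : ℕ → E) (M : ℕ) : Fin M → E := fun ℓ => ω ℓ

lemma measurable_firstSamples {E : Type*} [MeasurableSpace E] (M : ℕ) :
    Measurable fun ω : ℕ → E => firstSamples ω M :=
  measurable_pi_lambda _ fun ℓ => measurable_pi_apply (ℓ : ℕ)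

lemma sum_firstSamples {E : Type*} (F : E → ℝ) (ω : ℕ → E) (M : ℕ) :
    ∑ ℓ, F (firstSamples ω M ℓ) = ∑ ℓ ∈ range M, F (ω ℓ) :=
  Fin.sum_univ_eq_sum_range (fun ℓ => F (ω ℓ)) M

lemma IsMarkovFamily.integral_startingAt (hPr : IsMarkovFamily P Pr) (hμ0 : ∀ i, 0 ≤ μ i)
    (hmix : ν = ∑ i : Fin n, ENNReal.ofReal (μ i) • Pr i) {F : (ℕ → Fin n) → ℝ} {t : ℕ}
    (hF : DependsUpTo F t) (k : Fin n) :
    ∫ ω, startingAt k F ω ∂ν = μ k * ∫ ω, F ω ∂(Pr k) := by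
  have := hPr.1
  rw [hmix, integral_finsetSum_measure fun i _ =>
    ((hF.startingAt k).integrable (Pr i)).smul_measure ENNReal.ofReal_ne_top]
  simp only [integral_smul_measure, ENNReal.toReal_ofReal (hμ0 _), smul_eq_mul]
  rw [Finset.sum_eq_single k]
  · congr 1
    refine integral_congr_ae ?_
    filter_upwards [hPr.ae_apply_zero k] with ω hω
    simp [startingAt, hω]
  · intro i _ hik
    rw [integral_eq_zero_of_ae, mul_zero]
    filter_upwards [hPr.ae_apply_zero i] with ω hω
    simp [startingAt, hω, hik]
  · simp

lemma IsMarkovFamily.integral_residual (hPr : IsMarkovFamily P Pr) (hP : IsStochastic P)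
    (hirr : IsIrreducible P) (hDne : D ≠ Finset.univ) {R : Fin n → ℝ} (hR : ∀ i, 0 ≤ R i)
    (τ : ℕ) (k : Fin n) : ∫ ω, residual D R (valueR Pr D R) τ ω ∂(Pr k) = 0 := by
  have := hPr.1
  have hint : ∀ (h : Fin n → ℝ) (t : ℕ), Integrable (fun ω => h (stopped D ω t)) (Pr k) :=
    fun h t => DependsUpTo.integrable (t := t)
      (fun ω ω' hω => congrArg h (dependsUpTo_stopped t ω ω' hω)) (Pr k)
  have h0 : ∫ ω, valueR Pr D R (ω 0) ∂(Pr k) = valueR Pr D R k := by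
    rw [integral_congr_ae (g := fun _ => valueR Pr D R k)]
    · simp
    · filter_upwards [hPr.ae_apply_zero k] with ω hω
      rw [hω]
  have hsum : Integrable (fun ω => ∑ t ∈ range τ, RD D R (stopped D ω t)) (Pr k) :=
    integrable_finsetSum _ fun t _ => hint (RD D R) t
  have hu : Integrable (fun ω => valueR Pr D R (stopped D ω τ)) (Pr k) := hint _ τ
  have hu0 : Integrable (fun ω => valueR Pr D R (ω 0)) (Pr k) := hint _ 0
  have hadd : Integrable (fun ω => ∑ t ∈ range τ, RD D R (stopped D ω t)
      + valueR Pr D R (stopped D ω τ)) (Pr k) := hsum.add hu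
  simp only [residual]
  rw [integral_sub hadd hu0, integral_add hsum hu,
    integral_finsetSum _ fun t _ => hint (RD D R) t, h0]
  simp only [hPr.integral_stopped]
  have := congrFun (valueR_eq_sum_add_stopMat_pow_mulVec hP hirr hDne hPr hR τ) k
  rw [Pi.add_apply, Finset.sum_apply] at this
  rw [← this, sub_self]

variable [IsProbabilityMeasure ν]

lemma ae_tendsto_startCount (hPr : IsMarkovFamily P Pr) (hμ0 : ∀ i, 0 ≤ μ i)
    (hmix : ν = ∑ i : Fin n, ENNReal.ofReal (μ i) • Pr i) (k : Fin n) :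
    ∀ᵐ ω ∂(samples ν), Tendsto (fun M : ℕ => (startCount (firstSamples ω M) k : ℝ) / M) atTop
      (𝓝 (μ k)) := by
  have := hPr.1
  have hF : DependsUpTo (fun _ : ℕ → Fin n => (1 : ℝ)) 0 := fun _ _ _ => rfl
  filter_upwards [ae_tendsto_average (hF.startingAt k).measurable
    ((hF.startingAt k).integrable ν)] with ω hω
  rw [hPr.integral_startingAt hμ0 hmix hF k] at hω
  simpa [startCount_eq_sum, sum_firstSamples] using hω

lemma eventually_startCount_ne_zero {ω : ℕ → ℕ → Fin n} {k : Fin n} (hk : 0 < μ k)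
    (h : Tendsto (fun M : ℕ => (startCount (firstSamples ω M) k : ℝ) / M) atTop (𝓝 (μ k))) :
    ∀ᶠ M in atTop, startCount (firstSamples ω M) k ≠ 0 := by
  filter_upwards [h.eventually_ne hk.ne'] with M hM h0
  exact hM (by rw [h0, Nat.cast_zero, zero_div])

lemma ae_tendsto_Stilde (hPr : IsMarkovFamily P Pr) (hμ0 : ∀ i, 0 ≤ μ i)
    (hmix : ν = ∑ i : Fin n, ENNReal.ofReal (μ i) • Pr i) {k : Fin n} (hk : 0 < μ k) (τ : ℕ)
    (j : Fin n) :
    ∀ᵐ ω ∂(samples ν), Tendsto (fun M : ℕ => Stilde D (firstSamples ω M) τ k j) atTop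
      (𝓝 ((stopMat P D ^ τ) k j)) := by
  have := hPr.1
  have hF : DependsUpTo (fun ω => Pi.single (M := fun _ : Fin n => ℝ) j 1 (stopped D ω τ)) τ :=
    fun ω ω' h => congrArg _ (dependsUpTo_stopped τ ω ω' h)
  filter_upwards [ae_tendsto_startCount hPr hμ0 hmix k, ae_tendsto_average
    (hF.startingAt k).measurable ((hF.startingAt k).integrable ν)] with ω hc hω
  rw [hPr.integral_startingAt hμ0 hmix hF k, hPr.integral_stopped, Matrix.mulVec_single_one] at hω
  have hlim := hω.div hc hk.ne'
  rw [mul_div_cancel_left₀ _ hk.ne'] at hlim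
  refine hlim.congr' ?_
  filter_upwards [eventually_startCount_ne_zero hk hc, eventually_ne_atTop 0] with M hM hM0
  have h := Stilde_mulVec (D := D) hM τ (Pi.single j 1)
  rw [Matrix.mulVec_single_one, sum_firstSamples] at h
  rw [Pi.div_apply, div_div_div_cancel_right₀ (Nat.cast_ne_zero.2 hM0)]
  exact h.symm

lemma ae_tendsto_one_sub_zeroD_Stilde (hPr : IsMarkovFamily P Pr) (hμ0 : ∀ i, 0 ≤ μ i)
    (hmix : ν = ∑ i : Fin n, ENNReal.ofReal (μ i) • Pr i) (hμpos : ∀ i ∈ D, 0 < μ i) (τ : ℕ) :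
    ∀ᵐ ω ∂(samples ν), Tendsto (fun M : ℕ => 1 - zeroD D (Stilde D (firstSamples ω M) τ)) atTop
      (𝓝 (1 - zeroD D (stopMat P D ^ τ))) := by
  have h : ∀ᵐ ω ∂(samples ν), ∀ k ∈ D, ∀ j, Tendsto
      (fun M : ℕ => Stilde D (firstSamples ω M) τ k j) atTop (𝓝 ((stopMat P D ^ τ) k j)) := by
    simp only [ae_all_iff]
    exact fun k hk j => ae_tendsto_Stilde hPr hμ0 hmix (hμpos k hk) τ j
  filter_upwards [h] with ω hω
  refine tendsto_const_nhds.sub (tendsto_pi_nhds.2 fun k => tendsto_pi_nhds.2 fun j => ?_)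
  by_cases hk : k ∈ D ∧ j ∈ D
  · simpa only [zeroD, if_pos hk] using hω k hk.1 j
  · simpa only [zeroD, if_neg hk] using tendsto_const_nhds

/-- The influence function of the LSTD estimator of `u i`. -/
def influence (D : Finset (Fin n)) (c : Fin n → ℝ) (F : (ℕ → Fin n) → ℝ) (ω : ℕ → Fin n) : ℝ :=
  ∑ k ∈ D, c k * startingAt k F ω

lemma DependsUpTo.influence {F : (ℕ → Fin n) → ℝ} {t : ℕ} (hF : DependsUpTo F t) (c : Fin n → ℝ) :
    DependsUpTo (influence D c F) t := fun ω ω' h =>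
  Finset.sum_congr rfl fun k _ => by rw [hF.startingAt k ω ω' h]

lemma influence_sq (c : Fin n → ℝ) (F : (ℕ → Fin n) → ℝ) (ω : ℕ → Fin n) :
    influence D c F ω ^ 2 = ∑ k ∈ D, c k ^ 2 * startingAt k (fun ω => F ω ^ 2) ω := by
  by_cases h : ω 0 ∈ D <;> simp [influence, startingAt, h, mul_pow]

lemma IsMarkovFamily.integral_influence (hPr : IsMarkovFamily P Pr) (hμ0 : ∀ i, 0 ≤ μ i)
    (hmix : ν = ∑ i : Fin n, ENNReal.ofReal (μ i) • Pr i) {F : (ℕ → Fin n) → ℝ} {t : ℕ}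
    (hF : DependsUpTo F t) (c : Fin n → ℝ) :
    ∫ ω, influence D c F ω ∂ν = ∑ k ∈ D, c k * (μ k * ∫ ω, F ω ∂(Pr k)) := by
  unfold influence
  rw [integral_finsetSum _ fun k _ => ((hF.startingAt k).integrable ν).const_mul _]
  simp only [integral_const_mul, hPr.integral_startingAt hμ0 hmix hF]

lemma IsMarkovFamily.integral_influence_sq (hPr : IsMarkovFamily P Pr) (hμ0 : ∀ i, 0 ≤ μ i)
    (hmix : ν = ∑ i : Fin n, ENNReal.ofReal (μ i) • Pr i) (hμpos : ∀ i ∈ D, 0 < μ i)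
    (R : Fin n → ℝ) (τ : ℕ) (i : Fin n) :
    ∫ ω, influence D (fun k => (1 - zeroD D (stopMat P D ^ τ))⁻¹ i k * (μ k)⁻¹)
      (residual D R (valueR Pr D R) τ) ω ^ 2 ∂ν = avar P Pr D R μ τ i := by
  have hF : DependsUpTo (fun ω => residual D R (valueR Pr D R) τ ω ^ 2) τ := fun ω ω' h =>
    congrArg (· ^ 2) (dependsUpTo_residual R _ τ ω ω' h)
  simp only [influence_sq]
  rw [integral_finsetSum _ fun k _ => ((hF.startingAt k).integrable ν).const_mul _]
  refine Finset.sum_congr rfl fun k hk => ?_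
  rw [integral_const_mul, hPr.integral_startingAt hμ0 hmix hF, ← mul_assoc]
  congr 1
  · have := (hμpos k hk).ne'
    field_simp
  · refine integral_congr_ae ?_
    filter_upwards [hPr.ae_apply_zero k] with ω hω
    rw [residual, hω]

/-- The coefficient by which the linearization of the LSTD error differs from its limit. -/
def coeffError (D : Finset (Fin n)) (τ : ℕ) (c : Fin n → ℝ) (i k : Fin n) {M : ℕ}
    (ωs : Fin M → ℕ → Fin n) : ℝ :=
  (1 - zeroD D (Stilde D ωs τ))⁻¹ i k * (M / startCount ωs k) - c k

lemma measurable_coeffError (τ : ℕ) (c : Fin n → ℝ) (i k : Fin n) (M : ℕ) :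
    Measurable (coeffError D τ c i k (M := M)) :=
  measurable_of_forall_eq_upTo (t := τ) fun _ _ h => by
    rw [coeffError, coeffError, Stilde_congr h, startCount_congr fun ℓ => h ℓ 0 τ.zero_le]

lemma sqrt_mul_lstd_sub_eq {M : ℕ} {ω : ℕ → ℕ → Fin n} {R u : Fin n → ℝ} {τ : ℕ}
    (hM : M ≠ 0) (hu : ∀ j ∉ D, u j = R j)
    (hcount : ∀ k ∈ D, startCount (firstSamples ω M) k ≠ 0)
    (hA : IsUnit (1 - zeroD D (Stilde D (firstSamples ω M) τ))) (c : Fin n → ℝ) (i : Fin n) :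
    √M * (lstd D R τ (firstSamples ω M) i - u i)
      = (√M)⁻¹ * ∑ ℓ ∈ range M, influence D c (residual D R u τ) (ω ℓ)
        + ∑ k ∈ D, coeffError D τ c i k (firstSamples ω M) *
          ((√M)⁻¹ * ∑ ℓ ∈ range M, startingAt k (residual D R u τ) (ω ℓ)) := by
  unfold influence
  rw [lstd_sub_eq hu hcount hA, Finset.sum_comm, Finset.mul_sum, Finset.mul_sum,
    ← Finset.sum_add_distrib]
  refine Finset.sum_congr rfl fun k hk => ?_
  rw [sum_firstSamples, ← Finset.mul_sum, coeffError]
  have hr : √(M : ℝ) ≠ 0 := (Real.sqrt_pos.2 (by positivity)).ne'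
  have hc : (startCount (firstSamples ω M) k : ℝ) ≠ 0 := Nat.cast_ne_zero.2 (hcount k hk)
  have hMr : (M : ℝ) = √M * √M := (Real.mul_self_sqrt M.cast_nonneg).symm
  generalize √(M : ℝ) = r at *
  rw [hMr]
  field_simp
  ring

/-- The central limit theorem for LSTD, with all estimators built from one infinite sequence of
independent samples. -/
theorem tendstoInDistribution_lstd (hDne : D ≠ Finset.univ) (hP : IsStochastic P)
    (hirr : IsIrreducible P) {R : Fin n → ℝ} (hR : ∀ i, 0 ≤ R i) {τ : ℕ} (hτ : 1 ≤ τ)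
    (hμ0 : ∀ i, 0 ≤ μ i) (hμpos : ∀ i ∈ D, 0 < μ i) (hPr : IsMarkovFamily P Pr)
    (hmix : ν = ∑ i : Fin n, ENNReal.ofReal (μ i) • Pr i) (i : Fin n) :
    TendstoInDistribution
      (fun (M : ℕ) ω => √M * (lstd D R τ (firstSamples ω M) i - valueR Pr D R i)) atTop id
      (fun _ => samples ν) (gaussianReal 0 (avar P Pr D R μ τ i).toNNReal) := by
  set A := 1 - zeroD D (stopMat P D ^ τ) with hA
  set c : Fin n → ℝ := fun k => A⁻¹ i k * (μ k)⁻¹ with hc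
  set F := residual D R (valueR Pr D R) τ with hF
  have hunit : IsUnit A := isUnit_one_sub_zeroD_stopMat_pow hP hirr hDne hτ
  have hdep : DependsUpTo F τ := dependsUpTo_residual R _ τ
  have hmean : ∀ k, ∫ ω, F ω ∂(Pr k) = 0 := hPr.integral_residual hP hirr hDne hR τ
  have hcounts : ∀ᵐ ω ∂(samples ν), ∀ k, Tendsto
      (fun M : ℕ => (startCount (firstSamples ω M) k : ℝ) / M) atTop (𝓝 (μ k)) :=
    ae_all_iff.2 fun k => ae_tendsto_startCount hPr hμ0 hmix k
  have hmat := ae_tendsto_one_sub_zeroD_Stilde hPr hμ0 hmix hμpos τ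
  have hX := tendstoInDistribution_scaledSum (ν := ν) (hdep.influence (D := D) c).measurable
    ((hdep.influence c).memLp 2 ν) (by simp [hPr.integral_influence hμ0 hmix hdep, hmean])
  rw [hPr.integral_influence_sq hμ0 hmix hμpos] at hX
  have hCm : ∀ k M, Measurable fun ω : ℕ → ℕ → Fin n =>
      coeffError D τ c i k (firstSamples ω M) := fun k M =>
    (measurable_coeffError τ c i k M).comp (measurable_firstSamples M)
  have hC : ∀ k ∈ D, TendstoInMeasure (samples ν)
      (fun M ω => coeffError D τ c i k (firstSamples ω M)) atTop fun _ => 0 := by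
    intro k hk
    refine tendstoInMeasure_of_tendsto_ae (fun M => (hCm k M).aestronglyMeasurable) ?_
    filter_upwards [hcounts, hmat] with ω hω hωA
    have hinv := tendsto_pi_nhds.1 (tendsto_pi_nhds.1 (tendsto_matrix_inv hunit hωA) i) k
    have hlim := (hinv.mul ((hω k).inv₀ (hμpos k hk).ne')).sub_const (c k)
    simpa [coeffError, hc] using hlim
  have hVm : ∀ k (M : ℕ), MemLp (fun ω : ℕ → ℕ → Fin n =>
      (√M)⁻¹ * ∑ ℓ ∈ range M, startingAt k F (ω ℓ)) 2 (samples ν) := fun k M =>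
    memLp_scaledSum (hdep.startingAt k).measurable ((hdep.startingAt k).memLp 2 ν) M
  have hY : ∀ k ∈ D, TendstoInMeasure (samples ν) (fun M ω =>
      coeffError D τ c i k (firstSamples ω M) *
        ((√M)⁻¹ * ∑ ℓ ∈ range M, startingAt k F (ω ℓ))) atTop fun _ => 0 := fun k hk =>
    tendstoInMeasure_mul_of_variance_le (hC k hk) (hVm k)
      (fun M => integral_scaledSum (hdep.startingAt k).measurable
        ((hdep.startingAt k).integrable ν)
        (by rw [hPr.integral_startingAt hμ0 hmix hdep, hmean, mul_zero]) M)
      fun M => variance_scaledSum_le (hdep.startingAt k).measurable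
        ((hdep.startingAt k).memLp 2 ν) M
  have hsum := tendstoInDistribution_add_sum hX D hY
    fun k _ M => (hCm k M).aemeasurable.mul (hVm k M).aemeasurable
  have hlm : ∀ M : ℕ, Measurable fun ω : ℕ → ℕ → Fin n =>
      √M * (lstd D R τ (firstSamples ω M) i - valueR Pr D R i) := fun M =>
    (((measurable_lstd R τ M i).comp (measurable_firstSamples M)).sub_const _).const_mul _
  have hEm := fun M => (hlm M).aemeasurable.sub (hsum.forall_aemeasurable M)
  have hE := tendstoInMeasure_of_tendsto_ae (g := fun _ => (0 : ℝ))
    (fun M => (hEm M).aestronglyMeasurable) (by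
      filter_upwards [hcounts, hmat] with ω hω hωA
      refine tendsto_const_nhds.congr' ?_
      have hne : ∀ᶠ M in atTop, ∀ k ∈ D, startCount (firstSamples ω M) k ≠ 0 :=
        (Filter.eventually_all_finset D).2 fun k hk =>
          eventually_startCount_ne_zero (hμpos k hk) (hω k)
      filter_upwards [hne, eventually_isUnit_matrix hunit hωA, eventually_ne_atTop 0]
        with M hM1 hM2 hM3
      rw [Pi.sub_apply, sqrt_mul_lstd_sub_eq hM3
        (fun j hj => valueR_of_notMem hP hirr hDne hPr hR hj) hM1 hM2 c i, sub_self])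
  have hfin := hsum.add_of_tendstoInMeasure_const hE hEm
  convert! hfin using 2 with M
  · ext ω
    simp
  · simp

end Limit

end Probability

/-- Theorem 1 of the paper, central limit theorem for LSTD: if `P` is
irreducible and `μ > 0` on `D`, then `√M (ũ_M(i) - u(i))` converges in distribution, as the
number of independent sample trajectories `M → ∞`, to `N(0, σ_i²)`. Convergence in distribution
is expressed by testing against every bounded continuous function. -/
theorem stmt3 {n : ℕ} (hn : 2 ≤ n) (D : Finset (Fin n)) (hD : D.Nonempty)
    (hDne : D ≠ Finset.univ)
    (P : Matrix (Fin n) (Fin n) ℝ) (hP : IsStochastic P) (hirr : IsIrreducible P)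
    (R : Fin n → ℝ) (hR : ∀ i, 0 ≤ R i)
    (τ : ℕ) (hτ : 1 ≤ τ)
    (μ : Fin n → ℝ) (hμ0 : ∀ i, 0 ≤ μ i) (hμ1 : ∑ i, μ i = 1)
    (hμsupp : ∀ i ∉ D, μ i = 0) (hμpos : ∀ i ∈ D, 0 < μ i)
    (Pr : Fin n → Measure (ℕ → Fin n)) (hPr : IsMarkovFamily P Pr)
    -- the common law of the sample trajectories: a trajectory of the chain with initial
    -- distribution `μ`
    (Prμ : Measure (ℕ → Fin n)) [IsProbabilityMeasure Prμ]
    (hmix : Prμ = ∑ i : Fin n, ENNReal.ofReal (μ i) • Pr i)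
    (i : Fin n) (hi : i ∈ D) :
    ∀ f : BoundedContinuousFunction ℝ ℝ,
      Tendsto
        (fun M : ℕ =>
          ∫ ωs : Fin M → ℕ → Fin n,
            f (Real.sqrt M * (lstd D R τ ωs i - valueR Pr D R i))
            ∂(Measure.pi fun _ : Fin M => Prμ))
        atTop
        (nhds (∫ x, f x ∂(ProbabilityTheory.gaussianReal 0
          (Real.toNNReal (avar P Pr D R μ τ i))))) := by
  intro f
  have h := (ProbabilityMeasure.tendsto_iff_forall_integral_tendsto.1
    (tendstoInDistribution_lstd hDne hP hirr hR hτ hμ0 hμpos hPr hmix i).tendsto) f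
  simp only [ProbabilityMeasure.coe_mk, Measure.map_id] at h
  refine h.congr fun M => ?_
  have hG : Measurable fun ωs : Fin M → ℕ → Fin n =>
      √M * (lstd D R τ ωs i - valueR Pr D R i) :=
    ((measurable_lstd R τ M i).sub_const _).const_mul _
  exact (integral_map (hG.comp (measurable_firstSamples M)).aemeasurable
    f.continuous.aestronglyMeasurable).trans
    (integral_pi_eq_integral_samples M (f.continuous.measurable.comp hG)).symm

end RareTD
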